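/- arXiv:2109.09175 — 8 statements merged into one kernel-verified Lean document; each statement's English description precedes it below -/
import Mathlib

section
/- Let T be a tree with infinitely many vertices, and let H be a group acting on T by graph automorphisms such that the action is proper and cocompact. Then H contains an element of infinite order. -/
namespace SimpleGraph

variable {V : Type*} {G : SimpleGraph V}

theorem IsTree.eq_of_adj_of_dist_lt (hG : G.IsTree) {u w x y : V} (hx : G.Adj u x)
    (hy : G.Adj u y) (hxd : G.dist x w < G.dist u w) (hyd : G.dist y w < G.dist u w) : x = y := by
  have key : ∀ z, G.Adj u z → G.dist z w < G.dist u w →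
      ∃ p : G.Walk u w, p.IsPath ∧ p.snd = z := by
    intro z hz hzd
    obtain ⟨q, hq⟩ := hG.connected.exists_walk_length_eq_dist z w
    have hle := G.dist_le (Walk.cons hz q)
    refine ⟨Walk.cons hz q, Walk.isPath_of_length_eq_dist _ ?_, by simp⟩
    rw [Walk.length_cons] at hle ⊢
    lia
  obtain ⟨p, hp, rfl⟩ := key x hx hxd
  obtain ⟨q, hq, rfl⟩ := key y hy hyd
  rw [(hG.existsUnique_path u w).unique hp hq]

theorem IsTree.dist_lt_of_dist_lt (hG : G.IsTree) {v : ℕ → V} {N : ℕ}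
    (hadj : ∀ k < N, G.Adj (v k) (v (k + 1))) (hne : ∀ k, k + 1 < N → v k ≠ v (k + 2))
    {i j : ℕ} (hij : i ≤ j) (hj : j < N) {w : V}
    (h : G.dist (v (j + 1)) w < G.dist (v j) w) : G.dist (v (i + 1)) w < G.dist (v i) w := by
  induction j, hij using Nat.le_induction with
  | base => exact h
  | succ j hij ih =>
    refine ih (by lia) ?_
    have hd := hG.dist_eq_dist_add_one_of_adj w (hadj j (by lia))
    rw [dist_comm, dist_comm (v := v (j + 1))] at hd
    by_contra hlt
    exact hne j hj (hG.eq_of_adj_of_dist_lt (hadj j (by lia)).symm (hadj (j + 1) hj) (by lia) h)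

variable {H : Type*} [Group H] [MulAction H V]

theorem Connected.dist_smul_smul (hG : G.Connected)
    (hadj : ∀ (g : H) (v w : V), G.Adj v w ↔ G.Adj (g • v) (g • w)) (g : H) (v w : V) :
    G.dist (g • v) (g • w) = G.dist v w := by
  have hle : ∀ (g : H) (v w : V), G.dist (g • v) (g • w) ≤ G.dist v w := by
    intro g v w
    obtain ⟨p, hp⟩ := hG.exists_walk_length_eq_dist v w
    let f : G →g G := ⟨fun x ↦ g • x, fun {a b} h ↦ (hadj g a b).1 h⟩
    rw [← hp, ← Walk.length_map f p]
    exact dist_le _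
  refine (hle g v w).antisymm ?_
  simpa using hle g⁻¹ (g • v) (g • w)

theorem Connected.finite_setOf_dist_le (hG : G.Connected)
    (hproper : ∀ (v : V) (m : ℕ), {g : H | G.dist v (g • v) ≤ m}.Finite)
    (hcocompact : Finite (MulAction.orbitRel.Quotient H V)) (v : V) (m : ℕ) :
    {w | G.dist v w ≤ m}.Finite := by
  have horbit : ∀ q : MulAction.orbitRel.Quotient H V,
      {w | G.dist v w ≤ m ∧ (Quotient.mk'' w : MulAction.orbitRel.Quotient H V) = q}.Finite := by
    intro q
    rcases Set.eq_empty_or_nonempty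
      {w | G.dist v w ≤ m ∧ (Quotient.mk'' w : MulAction.orbitRel.Quotient H V) = q}
      with he | ⟨x, hx, rfl⟩
    · simp [he]
    · refine ((hproper x (2 * m)).image (· • x)).subset ?_
      rintro w ⟨hw, hwx⟩
      obtain ⟨g, rfl⟩ := MulAction.orbitRel_apply.1 (Quotient.exact hwx)
      refine ⟨g, ?_, rfl⟩
      have htri := hG.dist_triangle (u := x) (v := v) (w := g • x)
      rw [dist_comm (u := x) (v := v)] at htri
      simp only [Set.mem_ofPred_eq] at hw ⊢
      lia
  refine (Set.finite_iUnion horbit).subset fun w hw ↦ ?_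
  exact Set.mem_iUnion.2 ⟨_, hw, rfl⟩

/-- A group element that carries one edge of a non-backtracking walk in a tree to a later one,
preserving its direction, has infinite order. -/
theorem IsTree.not_isOfFinOrder_of_smul_eq (hG : G.IsTree)
    (hadj : ∀ (g : H) (v w : V), G.Adj v w ↔ G.Adj (g • v) (g • w)) {v : ℕ → V} {N : ℕ}
    (hv : ∀ k < N, G.Adj (v k) (v (k + 1))) (hne : ∀ k, k + 1 < N → v k ≠ v (k + 2))
    {i j : ℕ} (hij : i < j) (hj : j < N) {g : H} (hgi : g • v i = v j)
    (hgi' : g • v (i + 1) = v (j + 1)) : ¬ IsOfFinOrder g := by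
  have hmove : ∀ w, G.dist (v (i + 1)) w < G.dist (v i) w →
      G.dist (v (j + 1)) (g • w) < G.dist (v j) (g • w) := by
    intro w hw
    rwa [← hgi, ← hgi', hG.connected.dist_smul_smul hadj, hG.connected.dist_smul_smul hadj]
  have hpow : ∀ n : ℕ, G.dist (v (i + 1)) (g ^ n • v (i + 1)) <
      G.dist (v i) (g ^ n • v (i + 1)) := by
    intro n
    induction n with
    | zero => simp [dist_eq_one_iff_adj.2 (hv i (by lia))]
    | succ n ih =>
      rw [pow_succ', mul_smul]
      exact hG.dist_lt_of_dist_lt hv hne hij.le hj (hmove _ ih)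
  intro hfin
  obtain ⟨n, hn, hgn⟩ := hfin.exists_pow_eq_one
  have hlt := hmove _ (hpow (n - 1))
  rw [← mul_smul, ← pow_succ', Nat.sub_add_cancel hn, hgn, one_smul] at hlt
  have := hG.dist_lt_of_dist_lt hv hne (Nat.succ_le_of_lt hij) hj hlt
  simp at this

end SimpleGraph


/-- Let `T` be a tree with infinitely many vertices, and let `H` be a group acting on `T`
by graph automorphisms such that the action is proper and cocompact.
Then `H` contains an element of infinite order. -/
theorem stmt0 {V : Type*} (T : SimpleGraph V) (hT : T.IsTree) [Infinite V]
    {H : Type*} [Group H] [MulAction H V]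
    (hadj : ∀ (g : H) (v w : V), T.Adj v w ↔ T.Adj (g • v) (g • w))
    (hproper : ∀ (v : V) (m : ℕ), {g : H | T.dist v (g • v) ≤ m}.Finite)
    (hcocompact : Finite (MulAction.orbitRel.Quotient H V)) :
    ∃ g : H, ¬ IsOfFinOrder g := by
  have hball := hT.connected.finite_setOf_dist_le hproper hcocompact
  let r : MulAction.orbitRel.Quotient H V → V := Quotient.out
  have hr : ∀ x : V, ∃ h : H, h • r (Quotient.mk'' x) = x := fun x ↦
    MulAction.orbitRel_apply.1 ((MulAction.orbitRel H V).symm (Quotient.mk_out x))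
  choose h hh using hr
  let F : Set (V × V) := ⋃ q, {r q} ×ˢ {w | T.dist (r q) w ≤ 1}
  have hFfin : F.Finite := Set.finite_iUnion fun q ↦ (Set.finite_singleton _).prod (hball (r q) 1)
  obtain ⟨a⟩ := hT.connected.nonempty
  obtain ⟨b, hb⟩ := (hball a (F.ncard + 1)).exists_notMem
  obtain ⟨p, hp, hlen⟩ := hT.connected.exists_path_of_dist a b
  simp only [Set.mem_ofPred_eq, not_le, ← hlen] at hb
  have hadjp : ∀ k < p.length, T.Adj (p.getVert k) (p.getVert (k + 1)) :=
    fun k hk ↦ p.adj_getVert_succ hk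
  have hnep : ∀ k, k + 1 < p.length → p.getVert k ≠ p.getVert (k + 2) := by
    intro k hk heq
    have := hp.getVert_injOn (by simp; lia) (by simp; lia) heq
    lia
  let f : ℕ → V × V := fun k ↦
    ((h (p.getVert k))⁻¹ • p.getVert k, (h (p.getVert k))⁻¹ • p.getVert (k + 1))
  have hfF : ∀ k < p.length, f k ∈ F := by
    intro k hk
    have hrk := inv_smul_eq_iff.2 (hh (p.getVert k)).symm
    refine Set.mem_iUnion.2 ⟨Quotient.mk'' (p.getVert k), hrk, ?_⟩
    simp only [Set.mem_ofPred_eq, f]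
    rw [← hrk, hT.connected.dist_smul_smul hadj, SimpleGraph.dist_eq_one_iff_adj.2 (hadjp k hk)]
  obtain ⟨i, j, hij, hj, hfij⟩ : ∃ i j, i < j ∧ j < p.length ∧ f i = f j := by
    obtain ⟨x, hx, y, hy, hxy, hfxy⟩ := Finset.exists_ne_map_eq_of_card_lt_of_maps_to
      (s := Finset.range p.length) (t := hFfin.toFinset) (f := f)
      (by rw [← Set.ncard_eq_toFinset_card F hFfin, Finset.card_range]; lia)
      (fun k hk ↦ by simpa using hfF k (by simpa using hk))
    rw [Finset.mem_range] at hx hy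
    rcases hxy.lt_or_gt with hlt | hlt
    · exact ⟨x, y, hlt, hy, hfxy⟩
    · exact ⟨y, x, hlt, hx, hfxy.symm⟩
  obtain ⟨h₁, h₂⟩ := Prod.mk.inj hfij
  refine ⟨h (p.getVert j) * (h (p.getVert i))⁻¹,
    hT.not_isOfFinOrder_of_smul_eq hadj hadjp hnep hij hj ?_ ?_⟩
  · rw [mul_smul, h₁, smul_inv_smul]
  · rw [mul_smul, h₂, smul_inv_smul]
end

section
/- Let T be a nonempty tree and let f be an automorphism of T of finite order. Then either f fixes some vertex of T, or f inverts some edge of T, i.e., there exist adjacent vertices v and w with f(v) = w and f(w) = v. -/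
/-- In a tree, a vertex has at most one neighbour that is closer to a given vertex. -/
theorem SimpleGraph.IsTree.eq_of_adj_of_dist_succ_eq {V : Type*} {T : SimpleGraph V}
    (hT : T.IsTree) {x a b c : V} (hb : T.Adj b a) (hc : T.Adj c a)
    (hxb : T.dist x a = T.dist x b + 1) (hxc : T.dist x a = T.dist x c + 1) : b = c := by
  obtain ⟨p, hp⟩ := hT.connected.exists_walk_length_eq_dist x b
  obtain ⟨q, hq⟩ := hT.connected.exists_walk_length_eq_dist x c
  have hp' : (p.concat hb).IsPath :=
    (p.concat hb).isPath_of_length_eq_dist (by simp [hp, hxb])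
  have hq' : (q.concat hc).IsPath :=
    (q.concat hc).isPath_of_length_eq_dist (by simp [hq, hxc])
  have h := (hT.existsUnique_path x a).unique hp' hq'
  simpa using congrArg SimpleGraph.Walk.penultimate h

/-- A walk without backtracking in a tree is geodesic. -/
theorem SimpleGraph.IsTree.dist_eq_of_nonbacktracking {V : Type*} {T : SimpleGraph V}
    (hT : T.IsTree) {u : ℕ → V} (hadj : ∀ i, T.Adj (u i) (u (i + 1)))
    (hne : ∀ i, u i ≠ u (i + 2)) (i : ℕ) : T.dist (u 0) (u i) = i := by
  induction i using Nat.strong_induction_on with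
  | _ i ih =>
    match i with
    | 0 => simp
    | 1 => exact SimpleGraph.dist_eq_one_iff_adj.2 (hadj 0)
    | i + 2 =>
      have h₀ := ih i (by omega)
      have h₁ := ih (i + 1) (by omega)
      rcases hT.dist_eq_dist_add_one_of_adj (u 0) (hadj (i + 1)) with h | h
      · exact absurd (hT.eq_of_adj_of_dist_succ_eq (hadj i) (hadj (i + 1)).symm
          (by omega) h) (hne i)
      · rw [h, h₁]

/-- Let `T` be a nonempty tree and `f` an automorphism of `T` of finite order.
Then `f` fixes a vertex or inverts an edge. -/
theorem stmt1 {V : Type*} (T : SimpleGraph V) (hT : T.IsTree)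
    (f : Equiv.Perm V) (hadj : ∀ v w : V, T.Adj v w ↔ T.Adj (f v) (f w))
    (hfin : IsOfFinOrder f) :
    (∃ v : V, f v = v) ∨ (∃ v w : V, T.Adj v w ∧ f v = w ∧ f w = v) := by
  by_contra! hcon
  obtain ⟨hfix, hinv⟩ := hcon
  have : Nonempty V := hT.connected.nonempty
  -- A vertex `v` of minimal displacement.
  obtain ⟨v, hv⟩ : ∃ v, ∀ w, T.dist v (f v) ≤ T.dist w (f w) :=
    ⟨Function.argmin fun v ↦ T.dist v (f v),
      fun w ↦ Function.argmin_le (fun v ↦ T.dist v (f v)) w⟩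
  obtain ⟨p, hp, hlen⟩ := hT.connected.exists_path_of_dist v (f v)
  set k := T.dist v (f v) with hk
  have hk0 : 0 < k := hT.connected.pos_dist_of_ne (hfix v).symm
  have hpow : ∀ (q : ℕ) {a b : V}, T.Adj a b → T.Adj ((f ^ q) a) ((f ^ q) b) := by
    intro q a b h
    induction q with
    | zero => simpa using h
    | succ q ih =>
      rw [pow_succ', Equiv.Perm.mul_apply, Equiv.Perm.mul_apply]
      exact (hadj _ _).1 ih
  -- The translates of the geodesic `p` from `v` to `f v` form a walk without backtracking.
  let u : ℕ → V := fun i ↦ (f ^ (i / k)) (p.getVert (i % k))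
  have hu : ∀ q r, r ≤ k → u (k * q + r) = (f ^ q) (p.getVert r) := by
    intro q r hr
    rcases hr.lt_or_eq with h | rfl
    · simp only [u, Nat.mul_add_div hk0, Nat.div_eq_of_lt h, Nat.mul_add_mod,
        Nat.mod_eq_of_lt h, add_zero]
    · have h₁ : p.getVert k = f v := by rw [← hlen, p.getVert_length]
      have h₂ : k * q + k = k * (q + 1) := by ring
      rw [h₁, h₂]
      simp only [u, Nat.mul_div_cancel_left _ hk0, Nat.mul_mod_right,
        SimpleGraph.Walk.getVert_zero, pow_succ, Equiv.Perm.mul_apply]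
  have hu_adj : ∀ i, T.Adj (u i) (u (i + 1)) := by
    intro i
    have hr := Nat.mod_lt i hk0
    rw [← Nat.div_add_mod i k, add_assoc, hu _ _ hr.le, hu _ _ hr]
    exact hpow _ (p.adj_getVert_succ (by omega))
  have hu_ne : ∀ i, u i ≠ u (i + 2) := by
    intro i
    have hr := Nat.mod_lt i hk0
    rw [← Nat.div_add_mod i k, add_assoc, hu _ _ hr.le]
    generalize i % k = r at hr
    generalize i / k = q
    by_cases h : r + 2 ≤ k
    · rw [hu _ _ h]
      intro heq
      have := hp.getVert_injOn (by simp; omega) (by simp; omega) ((f ^ q).injective heq)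
      omega
    · have h₁ : k * q + (r + 2) = k * (q + 1) + 1 := by
        rw [mul_add]; omega
      rw [h₁, hu _ _ hk0, pow_succ, Equiv.Perm.mul_apply]
      intro heq
      have heq := (f ^ q).injective heq
      rcases Nat.eq_zero_or_pos r with rfl | hr0
      · have hk1 : p.getVert 1 = f v := by
          rw [show 1 = p.length by omega, p.getVert_length]
        rw [hk1, p.getVert_zero] at heq
        exact hinv v (f v) (SimpleGraph.dist_eq_one_iff_adj.1 (by omega)) rfl heq.symm
      · have hmin := hv (p.getVert 1)
        rw [← heq] at hmin
        have hle := (SimpleGraph.dist_le ((p.drop 1).take (r - 1))).trans_eq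
          (SimpleGraph.Walk.take_length _ _)
        rw [SimpleGraph.Walk.drop_getVert, show 1 + (r - 1) = r by omega] at hle
        omega
  obtain ⟨n, hn, hfn⟩ := isOfFinOrder_iff_pow_eq_one.1 hfin
  have hdist := hT.dist_eq_of_nonbacktracking hu_adj hu_ne (k * n)
  have h₀ : u (k * n) = u 0 := by
    have h₁ := hu n 0 hk0.le
    have h₂ := hu 0 0 hk0.le
    rw [hfn] at h₁
    exact h₁.trans h₂.symm
  rw [h₀, SimpleGraph.dist_self] at hdist
  exact (Nat.mul_pos hk0 hn).ne hdist
end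

section
/- Let T be a tree and let a and b be automorphisms of T such that the set of vertices fixed by a and the set of vertices fixed by b are both nonempty and are disjoint from each other. Then the automorphism a∘b has infinite order. -/
namespace SimpleGraph

variable {V : Type*} {T : SimpleGraph V}

lemma IsTree.length_eq_dist_of_isPath (hT : T.IsTree) {u v : V} {p : T.Walk u v}
    (hp : p.IsPath) : p.length = T.dist u v := by
  obtain ⟨q, hq, hlen⟩ := hT.connected.exists_path_of_dist u v
  rw [(hT.existsUnique_path u v).unique hp hq, hlen]

/-- If two paths in a forest start at the same vertex along different edges, then reversing the
first one and continuing along the second one gives a path. -/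
lemma IsAcyclic.isPath_reverse_append (hT : T.IsAcyclic) {x u u' y z : V} {h : T.Adj x u}
    {h' : T.Adj x u'} {p : T.Walk u y} {q : T.Walk u' z} (hp : (Walk.cons h p).IsPath)
    (hq : (Walk.cons h' q).IsPath) (hne : u ≠ u') :
    ((Walk.cons h p).reverse.append (Walk.cons h' q)).IsPath := by
  rw [hT.isPath_iff_isChain, Walk.edges_append, List.isChain_append]
  refine ⟨(hT.isPath_iff_isChain _).1 hp.reverse, (hT.isPath_iff_isChain _).1 hq, ?_⟩
  simpa [Walk.edges_reverse, h.ne'] using hne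

/-- Let `a` be an automorphism of a tree fixing `x` but not the next vertex on the path from `x`
to `y`. Then `a` maps every vertex beyond `y`, seen from `x`, to a vertex beyond `x`, seen
from `y`. -/
lemma IsTree.dist_apply_eq_of_fixed (hT : T.IsTree) (a : T ≃g T) {x y v : V} (hx : a x = x)
    (hxy : x ≠ y) (hmin : ∀ u, a u = u → T.dist x y ≤ T.dist u y)
    (hv : T.dist x v = T.dist x y + T.dist y v) :
    T.dist y (a v) = T.dist x y + T.dist x v := by
  obtain ⟨p, -, hp⟩ := hT.connected.exists_path_of_dist x y
  obtain ⟨r, -, hr⟩ := hT.connected.exists_path_of_dist y v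
  have hpr : (p.append r).IsPath :=
    Walk.isPath_of_length_eq_dist _ (by rw [Walk.length_append, hp, hr, hv])
  cases p with
  | nil => exact absurd rfl hxy
  | @cons _ u _ h p =>
    have hu : u ≠ a u := fun hu ↦ by
      have h1 := hmin u hu.symm
      have h2 := T.dist_le p
      rw [Walk.length_cons] at hp
      omega
    have h' : T.Adj x (a u) := by simpa [hx] using a.map_adj_iff.2 h
    have hq : (Walk.cons h' ((p.append r).map a.toHom)).IsPath := by
      have := hpr.map (f := a.toHom) a.injective
      rw [Walk.isPath_def] at this ⊢
      simpa [hx] using this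
    have hpath := hT.isAcyclic.isPath_reverse_append hpr.of_append_left hq hu
    have hlen := hT.length_eq_dist_of_isPath hpath
    simp only [Walk.length_append, Walk.length_reverse, Walk.length_cons, Walk.length_map]
      at hlen hp
    change _ = T.dist y (a v) at hlen
    omega

lemma Iso.dist_apply (a : T ≃g T) (hT : T.Connected) (u v : V) :
    T.dist (a u) (a v) = T.dist u v := by
  have key (b : T ≃g T) (u v : V) : T.dist (b u) (b v) ≤ T.dist u v := by
    obtain ⟨p, hp⟩ := hT.exists_walk_length_eq_dist u v
    rw [← hp, ← Walk.length_map b.toHom p]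
    exact T.dist_le _
  exact (key a u v).antisymm (by simpa using key a.symm (a u) (a v))

end SimpleGraph


/-- Let `T` be a tree and `a`, `b` automorphisms of `T` whose (nonempty) fixed-vertex sets
are disjoint. Then `a ∘ b` has infinite order. -/
theorem stmt2 {V : Type*} (T : SimpleGraph V) (hT : T.IsTree)
    (a b : Equiv.Perm V)
    (ha : ∀ v w : V, T.Adj v w ↔ T.Adj (a v) (a w))
    (hb : ∀ v w : V, T.Adj v w ↔ T.Adj (b v) (b w))
    (haf : {v : V | a v = v}.Nonempty) (hbf : {v : V | b v = v}.Nonempty)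
    (hdisj : Disjoint {v : V | a v = v} {v : V | b v = v}) :
    ¬ IsOfFinOrder (a * b) := by
  let f : T ≃g T := ⟨a, (ha _ _).symm⟩
  let g : T ≃g T := ⟨b, (hb _ _).symm⟩
  obtain ⟨⟨x, y⟩, ⟨hx, hy⟩, hmin⟩ := exists_minimalFor_of_wellFoundedLT
    (fun z : V × V ↦ a z.1 = z.1 ∧ b z.2 = z.2) (fun z ↦ T.dist z.1 z.2)
    ⟨(haf.some, hbf.some), haf.some_mem, hbf.some_mem⟩
  replace hmin (u w : V) (hu : a u = u) (hw : b w = w) : T.dist x y ≤ T.dist u w :=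
    (le_total _ _).elim id (hmin (j := (u, w)) ⟨hu, hw⟩)
  have hxy : x ≠ y := fun h ↦ Set.disjoint_left.1 hdisj hx (h ▸ hy)
  have hpos := hT.connected.pos_dist_of_ne hxy
  have step (v : V) (hv : T.dist y v = T.dist x y + T.dist x v) :
      T.dist x ((a * b) v) = T.dist x v + 2 * T.dist x y ∧
        T.dist y ((a * b) v) = T.dist x y + T.dist x ((a * b) v) := by
    have h1 : T.dist x (b v) = T.dist y x + T.dist y v :=
      hT.dist_apply_eq_of_fixed g hy hxy.symm
        (fun u hu ↦ by rw [T.dist_comm, T.dist_comm (u := u)]; exact hmin x u hx hu)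
        (by rw [hv, T.dist_comm (u := y)])
    have h2 : T.dist y (b v) = T.dist y v := by
      simpa [g, hy] using g.dist_apply hT.connected y v
    have h3 : T.dist y (a (b v)) = T.dist x y + T.dist x (b v) :=
      hT.dist_apply_eq_of_fixed f hx hxy (fun u hu ↦ hmin u y hu hy)
        (by rw [h1, h2, T.dist_comm (u := y)])
    have h4 : T.dist x (a (b v)) = T.dist x (b v) := by
      simpa [f, hx] using f.dist_apply hT.connected x (b v)
    rw [T.dist_comm (u := y) (v := x)] at h1
    rw [Equiv.Perm.mul_apply]
    omega
  have orbit (n : ℕ) : T.dist x (((a * b) ^ n) x) = 2 * n * T.dist x y ∧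
      T.dist y (((a * b) ^ n) x) = T.dist x y + T.dist x (((a * b) ^ n) x) := by
    induction n with
    | zero => simp [T.dist_comm]
    | succ n ih =>
      obtain ⟨h1, h2⟩ := step _ ih.2
      rw [pow_succ', Equiv.Perm.mul_apply]
      exact ⟨by rw [h1, ih.1]; ring, h2⟩
  rw [isOfFinOrder_iff_pow_eq_one]
  rintro ⟨n, hn, h⟩
  have := (orbit n).1
  rw [h, Equiv.Perm.one_apply, SimpleGraph.dist_self] at this
  have : 0 < 2 * n * T.dist x y := by positivity
  omega
end

section
/- Let T be a nonempty tree and let H be a finite group acting on T by graph automorphisms. Then either there is a vertex fixed by every element of H, or there is an edge {v,w} of T whose vertex pair is preserved setwise by every element of H. -/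
namespace SimpleGraph

variable {V : Type*} {G : SimpleGraph V}

/-- A graph homomorphism from a connected graph does not increase distances. -/
theorem Connected.dist_map_le {W : Type*} {G' : SimpleGraph W} (hG : G.Connected) (f : G →g G')
    (u v : V) : G'.dist (f u) (f v) ≤ G.dist u v := by
  obtain ⟨p, hp⟩ := hG.exists_walk_length_eq_dist u v
  simpa [hp] using dist_le (p.map f)

/-- In a tree, at most one neighbour of `u` is closer to `x` than `u` is. -/
theorem IsTree.eq_of_adj_of_dist_eq_add_one (hG : G.IsTree) {u a c x : V} (ha : G.Adj u a)
    (hc : G.Adj u c) (hax : G.dist u x = G.dist a x + 1) (hcx : G.dist u x = G.dist c x + 1) :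
    a = c := by
  obtain ⟨p, hp⟩ := hG.connected.exists_walk_length_eq_dist a x
  obtain ⟨q, hq⟩ := hG.connected.exists_walk_length_eq_dist c x
  have hp' : (Walk.cons ha p).IsPath := Walk.isPath_of_length_eq_dist _ (by simp [hp, hax])
  have hq' : (Walk.cons hc q).IsPath := Walk.isPath_of_length_eq_dist _ (by simp [hq, hcx])
  have h := (hG.existsUnique_path u x).unique hp' hq'
  simpa using congrArg Walk.snd h

/-- If the first step of a path in a tree moves away from `x`, so do all later steps. -/
theorem IsTree.dist_eq_dist_add_length_of_isPath_cons (hG : G.IsTree) {a c b : V} (h : G.Adj a c)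
    (p : G.Walk c b) (hp : (Walk.cons h p).IsPath) {x : V} (hx : G.dist c x = G.dist a x + 1) :
    G.dist b x = G.dist c x + p.length := by
  induction p generalizing a with
  | nil => simp
  | @cons c d b h' q ih =>
    have had : a ≠ d := by
      rintro rfl
      simp [Walk.cons_isPath_iff] at hp
    have hd : G.dist d x = G.dist c x + 1 := by
      have h1 := hG.dist_eq_dist_add_one_of_adj x h'
      rw [dist_comm (u := x), dist_comm (u := x)] at h1
      rcases h1 with h1 | h1
      · exact absurd (hG.eq_of_adj_of_dist_eq_add_one h.symm h' hx h1) had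
      · exact h1
    rw [ih h' hp.of_cons hd, hd, Walk.length_cons]
    omega

/-- In a tree, two vertices minimizing the eccentricity relative to a nonempty finite family of
vertices are equal or adjacent. -/
theorem IsTree.eq_or_adj_of_forall_sup_dist_le (hG : G.IsTree) {ι : Type*} (s : Finset ι)
    (hs : s.Nonempty) (y : ι → V) {a b : V}
    (ha : ∀ v, s.sup (fun i ↦ G.dist a (y i)) ≤ s.sup (fun i ↦ G.dist v (y i)))
    (hb : ∀ v, s.sup (fun i ↦ G.dist b (y i)) ≤ s.sup (fun i ↦ G.dist v (y i))) :
    a = b ∨ G.Adj a b := by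
  obtain ⟨p, hp, -⟩ := hG.connected.exists_path_of_dist a b
  cases p with
  | nil => exact .inl rfl
  | @cons _ c _ h q =>
    refine .inr ?_
    cases q with
    | nil => exact h
    | cons h' q =>
      exfalso
      obtain ⟨i, hi, hci⟩ := s.exists_mem_eq_sup hs (fun i ↦ G.dist c (y i))
      have h1 : G.dist a (y i) ≤ s.sup (fun i ↦ G.dist a (y i)) :=
        Finset.le_sup (f := fun i ↦ G.dist a (y i)) hi
      have h2 : G.dist b (y i) ≤ s.sup (fun i ↦ G.dist b (y i)) :=
        Finset.le_sup (f := fun i ↦ G.dist b (y i)) hi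
      have h3 := ha c
      have h4 := hb a
      have h5 := hG.dist_eq_dist_add_one_of_adj (y i) h
      rw [dist_comm (u := y i), dist_comm (u := y i)] at h5
      rcases h5 with h5 | h5
      · omega
      · have h6 := hG.dist_eq_dist_add_length_of_isPath_cons h _ hp h5
        rw [Walk.length_cons] at h6
        omega

end SimpleGraph


/-- Let `T` be a nonempty tree and `H` a finite group acting on `T` by graph automorphisms.
Then either there is a vertex fixed by every element of `H`, or there is an edge whose
vertex pair is preserved setwise by every element of `H`. -/
theorem stmt3 {V : Type*} (T : SimpleGraph V) (hT : T.IsTree)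
    {H : Type*} [Group H] [Finite H] [MulAction H V]
    (hadj : ∀ (g : H) (v w : V), T.Adj v w ↔ T.Adj (g • v) (g • w)) :
    (∃ v : V, ∀ g : H, g • v = v) ∨
      (∃ v w : V, T.Adj v w ∧
        ∀ g : H, (g • v = v ∧ g • w = w) ∨ (g • v = w ∧ g • w = v)) := by
  classical
  have := Fintype.ofFinite H
  have hV := hT.connected.nonempty
  let x : V := hV.some
  have hle : ∀ (g : H) (u v : V), T.dist (g • u) (g • v) ≤ T.dist u v := fun g u v ↦
    hT.connected.dist_map_le ⟨(g • ·), (hadj g _ _).1⟩ u v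
  set e : V → ℕ := fun v ↦ Finset.univ.sup fun h : H ↦ T.dist v (h • x)
  have he_smul : ∀ (g : H) (v : V), e (g • v) ≤ e v := by
    refine fun g v ↦ Finset.sup_le fun h _ ↦ ?_
    calc T.dist (g • v) (h • x) = T.dist (g • v) (g • (g⁻¹ * h) • x) := by
          rw [smul_smul, mul_inv_cancel_left]
      _ ≤ T.dist v ((g⁻¹ * h) • x) := hle _ _ _
      _ ≤ e v := Finset.le_sup (f := fun h : H ↦ T.dist v (h • x)) (Finset.mem_univ _)
  obtain ⟨v, hv⟩ : ∃ v, ∀ u, e v ≤ e u :=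
    ⟨Function.argmin e, fun u ↦ Function.argmin_le e u⟩
  have hmin : ∀ {a b : V}, (∀ u, e a ≤ e u) → (∀ u, e b ≤ e u) → a = b ∨ T.Adj a b :=
    fun ha hb ↦ hT.eq_or_adj_of_forall_sup_dist_le Finset.univ Finset.univ_nonempty _ ha hb
  have hsmul : ∀ (g : H) {a : V}, (∀ u, e a ≤ e u) → ∀ u, e (g • a) ≤ e u :=
    fun g a ha u ↦ (he_smul g a).trans (ha u)
  by_cases hfix : ∀ g : H, g • v = v
  · exact .inl ⟨v, hfix⟩
  push Not at hfix
  obtain ⟨k, hk⟩ := hfix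
  have hw := hsmul k hv
  generalize k • v = w at hk hw
  have hvw : T.Adj v w := (hmin hv hw).resolve_left hk.symm
  have hpair : ∀ {a : V}, (∀ u, e a ≤ e u) → a = v ∨ a = w := by
    intro a ha
    rcases hmin hv ha with h | hva
    · exact .inl h.symm
    rcases hmin hw ha with h | hwa
    · exact .inr h.symm
    exact absurd ((SimpleGraph.dist_eq_one_iff_adj.2 hvw).trans
      (SimpleGraph.dist_eq_one_iff_adj.2 hva).symm) (hT.dist_ne_of_adj v hwa)
  refine .inr ⟨v, w, hvw, fun g ↦ ?_⟩
  have hne : g • v ≠ g • w := fun h ↦ hk (MulAction.injective g h).symm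
  rcases hpair (hsmul g hv) with h1 | h1 <;> rcases hpair (hsmul g hw) with h2 | h2
  · exact absurd (h1.trans h2.symm) hne
  · exact .inl ⟨h1, h2⟩
  · exact .inr ⟨h1, h2⟩
  · exact absurd (h1.trans h2.symm) hne
end

section
/- Let n ≥ 1 and let T_1, …, T_n be locally finite trees, each with infinitely many vertices. Let G be a group acting on each T_i by graph automorphisms, and suppose the diagonal action of G on the product V(T_1) × ⋯ × V(T_n) of the vertex sets is proper (for every tuple (v_1,…,v_n) of vertices and every natural number m, the set {g ∈ G : dist(v_j, g·v_j) ≤ m for all j} is finite) and cocompact (there are only finitely many G-orbits of tuples). Fix an index i and a base tuple v = (v_1,…,v_n), and let G_i = {g ∈ G : g·v_j = v_j for all j ≠ i}. Then the action of G_i on T_i is proper and cocompact (finitely many G_i-orbits of vertices of T_i), and G_i contains an element of infinite order. -/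
/-- In a locally finite connected graph, closed balls are finite. -/
theorem SimpleGraph.Connected.finite_setOf_dist_le_s4 {V : Type*} {T : SimpleGraph V}
    (hT : T.Connected) (hlf : ∀ v, (T.neighborSet v).Finite) (v : V) (r : ℕ) :
    {w | T.dist v w ≤ r}.Finite := by
  induction r with
  | zero =>
    refine (Set.finite_singleton v).subset fun w hw => ?_
    exact (hT.dist_eq_zero_iff.1 (Nat.le_zero.1 hw)).symm
  | succ r ih =>
    refine (ih.union (ih.biUnion fun u _ => hlf u)).subset fun w hw => ?_
    obtain ⟨p, hp⟩ := hT.exists_walk_length_eq_dist v w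
    by_cases hnil : p.Nil
    · have h0 : T.dist v w = 0 := by rw [← hp, Walk.length_eq_zero_iff.2 hnil]
      exact Or.inl (show T.dist v w ≤ r by omega)
    · refine Or.inr (Set.mem_biUnion (x := p.penultimate) ?_ (p.adj_penultimate hnil))
      have hle := T.dist_le p.dropLast
      have hlen := p.length_dropLast
      have hw' : T.dist v w ≤ r + 1 := hw
      show T.dist v p.penultimate ≤ r
      omega

/-- In a tree, every vertex has at most one neighbor closer to a given vertex. -/
theorem SimpleGraph.IsTree.eq_of_adj_of_dist_lt_s4 {V : Type*} {T : SimpleGraph V} (hT : T.IsTree)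
    {v x y z : V} (hx : T.Adj x y) (hz : T.Adj z y) (hxv : T.dist v x < T.dist v y)
    (hzv : T.dist v z < T.dist v y) : x = z := by
  obtain ⟨p, hp⟩ := hT.connected.exists_walk_length_eq_dist v x
  obtain ⟨q, hq⟩ := hT.connected.exists_walk_length_eq_dist v z
  have hx' := hT.dist_eq_dist_add_one_of_adj v hx
  have hz' := hT.dist_eq_dist_add_one_of_adj v hz
  have hpp : (p.concat hx).IsPath := Walk.isPath_of_length_eq_dist _ (by
    rw [Walk.length_concat]; omega)
  have hqq : (q.concat hz).IsPath := Walk.isPath_of_length_eq_dist _ (by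
    rw [Walk.length_concat]; omega)
  have h := congrArg Subtype.val
    ((hT.isAcyclic.subsingleton_path v y).elim ⟨_, hpp⟩ ⟨_, hqq⟩)
  exact (Walk.concat_inj h).1

/-- The vertices closer to `b` than to `a`. -/
def SimpleGraph.halfSpace {V : Type*} (T : SimpleGraph V) (a b : V) : Set V :=
  {v | T.dist v b < T.dist v a}

theorem SimpleGraph.IsTree.halfSpace_subset {V : Type*} {T : SimpleGraph V} (hT : T.IsTree)
    {x y z : V} (hxy : T.Adj x y) (hyz : T.Adj y z) (hxz : x ≠ z) :
    T.halfSpace y z ⊆ T.halfSpace x y := by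
  intro v hv
  by_contra h
  have hne := hT.dist_ne_of_adj v hxy
  have hle : ¬ T.dist v y < T.dist v x := h
  exact hxz (hT.eq_of_adj_of_dist_lt_s4 hxy hyz.symm (by omega) hv)

theorem SimpleGraph.IsTree.halfSpace_getVert_subset {V : Type*} {T : SimpleGraph V}
    (hT : T.IsTree) {u w : V} {p : T.Walk u w} (hp : p.IsPath) {k l : ℕ} (hkl : k ≤ l)
    (hl : l < p.length) :
    T.halfSpace (p.getVert l) (p.getVert (l + 1)) ⊆
      T.halfSpace (p.getVert k) (p.getVert (k + 1)) := by
  induction l, hkl using Nat.le_induction with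
  | base => exact subset_rfl
  | succ l hkl ih =>
    refine (hT.halfSpace_subset (p.adj_getVert_succ (by omega)) (p.adj_getVert_succ hl) ?_).trans
      (ih (by omega))
    intro h
    have := hp.getVert_injOn (by simp; omega) (by simp; omega) h
    omega

theorem SimpleGraph.IsTree.halfSpace_getVert_ssubset {V : Type*} {T : SimpleGraph V}
    (hT : T.IsTree) {u w : V} {p : T.Walk u w} (hp : p.IsPath) {k l : ℕ} (hkl : k < l)
    (hl : l < p.length) :
    T.halfSpace (p.getVert l) (p.getVert (l + 1)) ⊂
      T.halfSpace (p.getVert k) (p.getVert (k + 1)) := by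
  refine (Set.ssubset_iff_of_subset (hT.halfSpace_getVert_subset hp hkl.le hl)).2
    ⟨p.getVert (k + 1), ?_, fun h => ?_⟩
  · have hadj := p.adj_getVert_succ (hkl.trans hl)
    have h1 := T.dist_eq_one_iff_adj.2 hadj.symm
    simp [halfSpace, h1]
  · have h' := hT.halfSpace_getVert_subset hp (Nat.succ_le_of_lt hkl) hl h
    simp [halfSpace] at h'

open scoped Pointwise in
/-- An element moving a set to a proper subset of itself has infinite order. -/
theorem not_isOfFinOrder_of_smul_ssubset {G X : Type*} [Group G] [MulAction G X] {g : G}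
    {s : Set X} (h : g • s ⊂ s) : ¬ IsOfFinOrder g := by
  have key : ∀ n : ℕ, g ^ (n + 1) • s ⊂ s := by
    intro n
    induction n with
    | zero => simpa using h
    | succ n ih =>
      rw [pow_succ', mul_smul]
      exact (Set.smul_set_mono ih.subset).trans_ssubset h
  rw [isOfFinOrder_iff_pow_eq_one]
  rintro ⟨n, hn, hgn⟩
  obtain ⟨m, rfl⟩ := Nat.exists_eq_succ_of_ne_zero hn.ne'
  have := key m
  rw [Nat.succ_eq_add_one] at hgn
  rw [hgn, one_smul] at this
  exact this.ne rfl

theorem SimpleGraph.Connected.dist_smul {V G : Type*} {T : SimpleGraph V} (hT : T.Connected)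
    [Group G] [MulAction G V] (hadj : ∀ (g : G) (v w : V), T.Adj v w ↔ T.Adj (g • v) (g • w))
    (g : G) (v w : V) : T.dist (g • v) (g • w) = T.dist v w := by
  have key : ∀ (g : G) (v w : V), T.dist (g • v) (g • w) ≤ T.dist v w := by
    intro g v w
    obtain ⟨p, hp⟩ := hT.exists_walk_length_eq_dist v w
    let f : T →g T := ⟨fun x => g • x, fun {a b} h => (hadj g a b).1 h⟩
    rw [← hp, ← p.length_map f]
    exact T.dist_le (p.map f)
  refine (key g v w).antisymm ?_
  simpa using key g⁻¹ (g • v) (g • w)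

open scoped Pointwise in
theorem SimpleGraph.Connected.smul_halfSpace {V G : Type*} {T : SimpleGraph V}
    (hT : T.Connected) [Group G] [MulAction G V]
    (hadj : ∀ (g : G) (v w : V), T.Adj v w ↔ T.Adj (g • v) (g • w)) (g : G) (a b : V) :
    g • T.halfSpace a b = T.halfSpace (g • a) (g • b) := by
  ext v
  rw [Set.mem_smul_set_iff_inv_smul_mem]
  have h := fun x => hT.dist_smul hadj g (g⁻¹ • v) x
  simp only [smul_inv_smul] at h
  simp [halfSpace, h]

open scoped Pointwise in
/-- A group acting cocompactly on an infinite locally finite tree contains an element of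
infinite order. -/
theorem SimpleGraph.IsTree.exists_not_isOfFinOrder {V G : Type*} [Infinite V]
    {T : SimpleGraph V} (hT : T.IsTree) (hlf : ∀ v, (T.neighborSet v).Finite) [Group G]
    [MulAction G V] (hadj : ∀ (g : G) (v w : V), T.Adj v w ↔ T.Adj (g • v) (g • w))
    [Finite (MulAction.orbitRel.Quotient G V)] : ∃ g : G, ¬ IsOfFinOrder g := by
  have hrep : ∀ v : V, ∃ g : G,
      g • v = Quotient.out (Quotient.mk'' v : MulAction.orbitRel.Quotient G V) := fun v =>
    MulAction.orbitRel_apply.1 (Quotient.mk_out (s := MulAction.orbitRel G V) v)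
  choose c hc using hrep
  let r : MulAction.orbitRel.Quotient G V → V := Quotient.out
  have hE : (⋃ a ∈ Set.range r, (Prod.mk a) '' T.neighborSet a).Finite :=
    (Set.finite_range r).biUnion fun a _ => (hlf a).image _
  obtain ⟨v⟩ := hT.connected.nonempty
  obtain ⟨w, hw⟩ := (hT.connected.finite_setOf_dist_le_s4 hlf v hE.toFinset.card).exists_notMem
  obtain ⟨p, hp, hlen⟩ := hT.connected.exists_path_of_dist v w
  have hw' : hE.toFinset.card < p.length := by
    rw [hlen]; exact not_le.1 hw
  obtain ⟨k, hk, l, hl, hkl, heq⟩ := Finset.exists_ne_map_eq_of_card_lt_of_maps_to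
    (s := Finset.range p.length) (t := hE.toFinset)
    (f := fun k => (c (p.getVert k) • p.getVert k, c (p.getVert k) • p.getVert (k + 1)))
    (by simpa using hw') (by
      intro k hk
      have hk' : k < p.length := by simpa using hk
      rw [Set.Finite.coe_toFinset]
      refine Set.mem_biUnion (x := c (p.getVert k) • p.getVert k) ⟨_, (hc _).symm⟩
        ⟨_, (hadj _ _ _).1 (p.adj_getVert_succ hk'), rfl⟩)
  wlog hlt : k < l generalizing k l
  · exact this l hl k hk hkl.symm heq.symm (by omega)
  obtain ⟨h1, h2⟩ := Prod.mk.inj heq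
  refine ⟨(c (p.getVert l))⁻¹ * c (p.getVert k), not_isOfFinOrder_of_smul_ssubset
    (s := T.halfSpace (p.getVert k) (p.getVert (k + 1))) ?_⟩
  rw [hT.connected.smul_halfSpace hadj, mul_smul, mul_smul, h1, h2, inv_smul_smul, inv_smul_smul]
  exact hT.halfSpace_getVert_ssubset hp hlt (by simpa using hl)

/-- The coordinate stabilizer of an action that is cocompact on a product is cocompact on the
remaining factor. -/
theorem finite_orbitRel_quotient_of_pi {ι : Type*} {V : ι → Type*} {G : Type*} [Group G]
    [∀ i, MulAction G (V i)] [Finite (MulAction.orbitRel.Quotient G (∀ i, V i))] (i : ι)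
    (v : ∀ j, V j) (S : Subgroup G) (hS : ∀ g, g ∈ S ↔ ∀ j, j ≠ i → g • v j = v j) :
    Finite (MulAction.orbitRel.Quotient S (V i)) := by
  classical
  let f : MulAction.orbitRel.Quotient S (V i) → MulAction.orbitRel.Quotient G (∀ i, V i) :=
    fun q => Quotient.mk'' (Function.update v i q.out)
  refine Finite.of_injective f fun a b hab => ?_
  obtain ⟨g, hg⟩ := MulAction.orbitRel_apply.1 (Quotient.exact hab)
  have hgj : ∀ j, g • Function.update v i b.out j = Function.update v i a.out j :=
    fun j => congrFun hg j
  have hgS : g ∈ S := (hS g).2 fun j hj => by simpa [hj] using hgj j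
  have hgi : g • b.out = a.out := by simpa using hgj i
  rw [← Quotient.out_eq a, ← Quotient.out_eq b]
  exact Quotient.sound (MulAction.orbitRel_apply.2 ⟨⟨g, hgS⟩, hgi⟩)


/-- Let `T 1, …, T n` (`n ≥ 1`) be locally finite trees with infinitely many vertices,
and let `G` act on each `T i` by graph automorphisms so that the diagonal action on the
product of the vertex sets is proper and cocompact.  Fix `i` and a base tuple `v`, and let
`Gᵢ = {g : G | g • v j = v j for all j ≠ i}`.  Then the action of `Gᵢ` on `T i` is proper
and cocompact, and `Gᵢ` contains an element of infinite order. -/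
theorem stmt4 {n : ℕ} (hn : 1 ≤ n) {V : Fin n → Type*} (T : ∀ i, SimpleGraph (V i))
    (htree : ∀ i, (T i).IsTree)
    (hlf : ∀ (i : Fin n) (v : V i), ((T i).neighborSet v).Finite)
    [∀ i, Infinite (V i)]
    {G : Type*} [Group G] [∀ i, MulAction G (V i)]
    (hadj : ∀ (i : Fin n) (g : G) (v w : V i), (T i).Adj v w ↔ (T i).Adj (g • v) (g • w))
    (hproper : ∀ (v : ∀ i, V i) (m : ℕ),
      {g : G | ∀ i, (T i).dist (v i) (g • v i) ≤ m}.Finite)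
    (hcocompact : Finite (MulAction.orbitRel.Quotient G (∀ i, V i)))
    (i : Fin n) (v : ∀ j, V j) :
    (∀ (w : V i) (m : ℕ),
        {g : G | (∀ j, j ≠ i → g • v j = v j) ∧ (T i).dist w (g • w) ≤ m}.Finite) ∧
    (Set.range (fun w : V i =>
        {w' : V i | ∃ g : G, (∀ j, j ≠ i → g • v j = v j) ∧ g • w = w'})).Finite ∧
    (∃ g : G, (∀ j, j ≠ i → g • v j = v j) ∧ ¬ IsOfFinOrder g) := by
  classical
  let S : Subgroup G := ⨅ j : {j // j ≠ i}, MulAction.stabilizer G (v j)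
  have hS : ∀ g, g ∈ S ↔ ∀ j, j ≠ i → g • v j = v j := fun g => by
    simp [S, Subgroup.mem_iInf]
  have hfin := finite_orbitRel_quotient_of_pi i v S hS
  refine ⟨fun w m => ?_, ?_, ?_⟩
  · refine (hproper (Function.update v i w) m).subset ?_
    rintro g ⟨hg, hm⟩ j
    by_cases hj : j = i
    · subst hj
      simpa using hm
    · simp [hj, hg j hj]
  · refine (Set.finite_range
      (MulAction.orbitRel.Quotient.orbit : MulAction.orbitRel.Quotient S (V i) → _)).subset ?_
    rintro _ ⟨w, rfl⟩
    refine ⟨Quotient.mk'' w, ?_⟩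
    rw [MulAction.orbitRel.Quotient.orbit_mk]
    ext w'
    constructor
    · rintro ⟨g, rfl⟩
      exact ⟨g, (hS g).1 g.2, rfl⟩
    · rintro ⟨g, hg, rfl⟩
      exact ⟨⟨g, (hS g).2 hg⟩, rfl⟩
  · obtain ⟨g, hg⟩ := (htree i).exists_not_isOfFinOrder (G := S) (hlf i)
      fun g v w => hadj i g v w
    exact ⟨g, (hS g).1 g.2, fun h => hg (Submonoid.isOfFinOrder_coe.1 h)⟩
end

section
/- Let n ≥ 1 and let T_1, …, T_n be locally finite trees, each with infinitely many vertices and each having at least three ends. Let G be a group acting on each T_i by graph automorphisms, and suppose the diagonal action of G on the product V(T_1) × ⋯ × V(T_n) of the vertex sets is proper (for every tuple (v_1,…,v_n) of vertices and every natural number m, the set {g ∈ G : dist(v_j, g·v_j) ≤ m for all j} is finite) and cocompact (there are only finitely many G-orbits of tuples). Then every element of the center of G has finite order. -/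
namespace SimpleGraph

variable {V : Type*} {H : SimpleGraph V}

/-- `H.JoinedOff S x y` says that some walk from `x` to `y` avoids the set `S`. -/
def JoinedOff (H : SimpleGraph V) (S : Set V) (x y : V) : Prop :=
  ∃ p : H.Walk x y, ∀ u ∈ p.support, u ∉ S

/-- The set of vertices at distance at most `r` from `o`. -/
def distBall (H : SimpleGraph V) (o : V) (r : ℕ) : Set V :=
  {u | H.dist o u ≤ r}

lemma JoinedOff.symm {S : Set V} {x y : V} : H.JoinedOff S x y → H.JoinedOff S y x := by
  rintro ⟨p, hp⟩
  exact ⟨p.reverse, by simpa using hp⟩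

lemma JoinedOff.trans {S : Set V} {x y z : V} :
    H.JoinedOff S x y → H.JoinedOff S y z → H.JoinedOff S x z := by
  rintro ⟨p, hp⟩ ⟨q, hq⟩
  refine ⟨p.append q, fun u hu => ?_⟩
  rw [Walk.mem_support_append_iff] at hu
  exact hu.elim (hp u) (hq u)

lemma JoinedOff.refl {S : Set V} {x : V} (hx : x ∉ S) : H.JoinedOff S x x :=
  ⟨Walk.nil, by simpa using hx⟩

lemma JoinedOff.cons {S : Set V} {x y z : V} (hx : x ∉ S) (h : H.Adj x y) :
    H.JoinedOff S y z → H.JoinedOff S x z := by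
  rintro ⟨p, hp⟩
  refine ⟨Walk.cons h p, fun u hu => ?_⟩
  rw [Walk.support_cons, List.mem_cons] at hu
  rcases hu with rfl | hu
  exacts [hx, hp u hu]

/-- A geodesic from `x` to `y` stays in the ball around `x` through `y`. -/
lemma Connected.joinedOff_of_dist_le (hc : H.Connected) {S : Set V} {x y : V}
    (h : ∀ u, H.dist x u ≤ H.dist x y → u ∉ S) : H.JoinedOff S x y := by
  classical
  obtain ⟨p, hp⟩ := hc.exists_walk_length_eq_dist x y
  refine ⟨p, fun u hu => h u ?_⟩
  rw [← hp]
  exact (dist_le (p.takeUntil u hu)).trans (p.length_takeUntil_le_length hu)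

/-- Any two points of a ball are joined within the ball. -/
lemma Connected.joinedOff_of_disjoint_distBall (hc : H.Connected) {S : Set V} {o : V} {r : ℕ}
    (hS : ∀ u ∈ H.distBall o r, u ∉ S) {x y : V} (hx : x ∈ H.distBall o r)
    (hy : y ∈ H.distBall o r) : H.JoinedOff S x y :=
  (hc.joinedOff_of_dist_le fun u hu => hS u (le_trans hu hx)).symm.trans
    (hc.joinedOff_of_dist_le fun u hu => hS u (le_trans hu hy))

/-- A walk either reaches a point of `B` avoiding `A`, or its end can be reached avoiding `B`. -/
lemma joinedOff_or_exists_joinedOff {A B : Set V} {o : V}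
    (hA : ∀ u ∈ A, H.JoinedOff B u o) (ho : o ∉ B) {v : V} (p : H.Walk v o) :
    H.JoinedOff B v o ∨ ∃ u ∈ B, H.JoinedOff A v u := by
  induction p with
  | nil => exact Or.inl (.refl ho)
  | @cons v w o h p ih =>
    by_cases hvA : v ∈ A
    · exact Or.inl (hA v hvA)
    by_cases hvB : v ∈ B
    · exact Or.inr ⟨v, hvB, .refl hvA⟩
    rcases ih hA ho with h' | ⟨u, hu, h'⟩
    · exact Or.inl (h'.cons hvB h)
    · exact Or.inr ⟨u, hu, h'.cons hvA h⟩

lemma Iso.dist_apply_s5 (f : H ≃g H) (hc : H.Connected) (x y : V) :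
    H.dist (f x) (f y) = H.dist x y := by
  have key (g : H ≃g H) (x y : V) : H.dist (g x) (g y) ≤ H.dist x y := by
    obtain ⟨p, hp⟩ := hc.exists_walk_length_eq_dist x y
    rw [← hp, ← p.length_map g.toHom]
    exact dist_le _
  refine (key f x y).antisymm ?_
  simpa using key f.symm (f x) (f y)

lemma JoinedOff.of_iso (f : H ≃g H) (hc : H.Connected) {o : V} {r : ℕ} {x y : V} :
    H.JoinedOff (H.distBall (f o) r) (f x) (f y) → H.JoinedOff (H.distBall o r) x y := by
  rintro ⟨p, hp⟩
  refine ⟨(p.map f.symm.toHom).copy (f.symm_apply_apply x) (f.symm_apply_apply y), fun u hu => ?_⟩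
  rw [Walk.support_copy, Walk.support_map, List.mem_map] at hu
  obtain ⟨w, hw, rfl⟩ := hu
  intro h
  refine hp w hw ?_
  have := f.dist_apply_s5 hc o (f.symm w)
  rw [f.apply_symm_apply] at this
  exact this.trans_le h

/-- If a ball separates points that lie far from it compared with the displacement of an
automorphism, and there are at least three of them, then the ball meets its image. -/
lemma Iso.dist_le_two_mul_of_separated (f : H ≃g H) (hc : H.Connected) {D R : ℕ}
    (hD : ∀ v, H.dist v (f v) ≤ D) {o : V} (v : Fin 3 → V)
    (hfar : ∀ i, R + D < H.dist o (v i))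
    (hsep : ∀ i j, H.JoinedOff (H.distBall o R) (v i) (v j) → i = j) :
    H.dist o (f o) ≤ 2 * R := by
  by_contra! hlt
  have hAB : ∀ u ∈ H.distBall (f o) R, u ∉ H.distBall o R := by
    intro u h1 h2
    have := hc.dist_triangle (u := o) (v := u) (w := f o)
    rw [H.dist_comm (u := u)] at this
    simp only [distBall, Set.mem_ofPred_eq] at h1 h2
    omega
  have hmove (i) : H.JoinedOff (H.distBall o R) (v i) (f (v i)) := by
    refine hc.joinedOff_of_dist_le fun u hu hu' => ?_
    have := hc.dist_triangle (u := o) (v := u) (w := v i)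
    rw [H.dist_comm (u := u)] at this
    have := hD (v i)
    have := hfar i
    simp only [distBall, Set.mem_ofPred_eq] at hu'
    omega
  have hsepA (i j) (h : H.JoinedOff (H.distBall o R) (f (v i)) (f (v j))) : i = j :=
    hsep i j (((hmove i).trans h).trans (hmove j).symm)
  have hsepB (i j) (h : H.JoinedOff (H.distBall (f o) R) (f (v i)) (f (v j))) : i = j :=
    hsep i j (h.of_iso f hc)
  have hoA : o ∈ H.distBall o R := by simp [distBall]
  have hoB : o ∉ H.distBall (f o) R := fun h => hAB o h hoA
  have alt (i) := joinedOff_or_exists_joinedOff (A := H.distBall o R)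
    (fun u hu => hc.joinedOff_of_disjoint_distBall (fun w hw hw' => hAB w hw' hw) hu hoA) hoB
    (hc.preconnected (f (v i)) o).some
  obtain ⟨i, j, hij, h⟩ := Fintype.exists_ne_map_eq_of_card_lt
    (fun i => (H.JoinedOff (H.distBall (f o) R) (f (v i)) o : Prop)) (by simp)
  simp only [eq_iff_iff] at h
  by_cases hi : H.JoinedOff (H.distBall (f o) R) (f (v i)) o
  · exact hij (hsepB i j (hi.trans (h.1 hi).symm))
  · obtain ⟨u, hu, hiu⟩ := (alt i).resolve_left hi
    obtain ⟨w, hw, hjw⟩ := (alt j).resolve_left (fun hj => hi (h.2 hj))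
    exact hij (hsepA i j
      ((hiu.trans (hc.joinedOff_of_disjoint_distBall hAB hu hw)).trans hjw.symm))

lemma Connected.finite_distBall (hc : H.Connected) (hlf : ∀ v, (H.neighborSet v).Finite)
    (o : V) (r : ℕ) : (H.distBall o r).Finite := by
  induction r with
  | zero =>
    refine (Set.finite_singleton o).subset fun u hu => ?_
    have : H.dist o u = 0 := Nat.le_zero.1 hu
    exact (hc.dist_eq_zero_iff.1 this).symm
  | succ r ih =>
    refine (ih.union (ih.biUnion fun v _ => hlf v)).subset fun u hu => ?_
    obtain ⟨p, hp⟩ := hc.exists_walk_length_eq_dist u o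
    cases p with
    | nil => exact Or.inl (by simp [distBall])
    | @cons _ w _ h p =>
      refine Or.inr (Set.mem_biUnion (x := w) ?_ h.symm)
      have h1 := dist_le p
      rw [Walk.length_cons] at hp
      rw [dist_comm] at h1 hp
      simp only [distBall, Set.mem_ofPred_eq] at hu ⊢
      omega

lemma JoinedOff.mem_componentCompl {S : Set V} {C : H.ComponentCompl S} {x y : V} :
    H.JoinedOff S x y → x ∈ C → y ∈ C := by
  rintro ⟨p, hp⟩
  induction p with
  | nil => exact id
  | @cons x w y h p ih =>
    intro hx
    refine ih (fun u hu => hp u (by simp [hu])) (ComponentCompl.mem_of_adj x w hx ?_ h)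
    exact hp w (by simp)

/-- The component of the complement of `K` chosen by an end. -/
def endComponent (e : H.end) (K : Finset V) : H.ComponentCompl K :=
  e.1 (Opposite.op K)

lemma mem_endComponent_mono (e : H.end) {K L : Finset V} (h : K ⊆ L) {x : V}
    (hx : x ∈ endComponent e L) : x ∈ endComponent e K := by
  have : (endComponent e L).hom (Finset.coe_subset.2 h) = endComponent e K :=
    e.2 (CategoryTheory.opHomOfLE (show K ≤ L from h))
  rw [← this]
  exact ComponentCompl.subset_hom _ (Finset.coe_subset.2 h) hx

/-- In a locally finite connected graph with at least three ends, automorphisms of bounded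
displacement move a given vertex by a uniformly bounded amount. -/
lemma Connected.exists_forall_dist_apply_le (hc : H.Connected)
    (hlf : ∀ v, (H.neighborSet v).Finite) (e : Fin 3 → H.end) (he : Function.Injective e) (o : V) :
    ∃ m : ℕ, ∀ f : H ≃g H, (∃ D, ∀ v, H.dist v (f v) ≤ D) → H.dist o (f o) ≤ m := by
  classical
  have hK (i j) : ∃ K : Finset V, i ≠ j → endComponent (e i) K ≠ endComponent (e j) K := by
    by_contra! h
    exact (h ∅).1 (he (Subtype.ext (funext fun K => (h K.unop).2)))
  choose K hK using hK
  obtain ⟨R, hR⟩ : ∃ R, ∀ i j, ∀ u ∈ K i j, H.dist o u ≤ R := by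
    refine ⟨(Finset.univ.biUnion fun ij : Fin 3 × Fin 3 => K ij.1 ij.2).sup (H.dist o),
      fun i j u hu => Finset.le_sup (f := H.dist o) ?_⟩
    simp only [Finset.mem_biUnion, Finset.mem_univ, true_and]
    exact ⟨(i, j), hu⟩
  refine ⟨2 * R, fun f ⟨D, hD⟩ => ?_⟩
  have hfin := hc.finite_distBall hlf o
  let B (r : ℕ) : Finset V := (hfin r).toFinset
  have hB (r : ℕ) : (B r : Set V) = H.distBall o r := (hfin r).coe_toFinset
  have hv (i) : ∃ x, x ∈ endComponent (e i) (B (R + D)) := ComponentCompl.nonempty _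
  choose v hv using hv
  refine f.dist_le_two_mul_of_separated hc hD v (fun i => ?_) fun i j hij => ?_
  · have := ComponentCompl.notMem_of_mem (hv i)
    rw [hB] at this
    simpa [distBall] using this
  · by_contra hne
    have hsub : B R ⊆ B (R + D) := by
      rw [← Finset.coe_subset, hB, hB]
      exact fun u (hu : _ ≤ _) => hu.trans (Nat.le_add_right R D)
    have hKB : K i j ⊆ B R := by
      rw [← Finset.coe_subset, hB]
      exact fun u hu => hR i j u hu
    have hi := mem_endComponent_mono (e i) hsub (hv i)
    have hj := mem_endComponent_mono (e j) hsub (hv j)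
    rw [← hB] at hij
    have hi' := mem_endComponent_mono (e i) hKB (hij.mem_componentCompl hi)
    have hj' := mem_endComponent_mono (e j) hKB hj
    exact Set.disjoint_left.1 (ComponentCompl.pairwise_disjoint (hK i j hne)) hi' hj'

end SimpleGraph

/-- An element commuting with a group whose action has finitely many orbits of tuples has bounded
displacement in each factor. -/
lemma exists_forall_dist_smul_le {ι : Type*} {V : ι → Type*} (T : ∀ i, SimpleGraph (V i))
    [∀ i, Nonempty (V i)] {G : Type*} [Group G] [∀ i, MulAction G (V i)]
    (hdist : ∀ (i : ι) (g : G) (v w : V i), (T i).dist (g • v) (g • w) = (T i).dist v w)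
    (hcocompact : Finite (MulAction.orbitRel.Quotient G (∀ i, V i)))
    {z : G} (hz : z ∈ Subgroup.center G) (i : ι) :
    ∃ D, ∀ v : V i, (T i).dist v (z • v) ≤ D := by
  classical
  let φ : MulAction.orbitRel.Quotient G (∀ i, V i) → ℕ :=
    Quotient.lift (fun x : ∀ i, V i => (T i).dist (x i) (z • x i)) (by
      rintro _ y ⟨g, rfl⟩
      change (T i).dist (g • y i) (z • g • y i) = _
      rw [smul_smul, ← Subgroup.mem_center_iff.1 hz g, ← smul_smul, hdist])
  obtain ⟨D, hD⟩ := (Set.finite_range φ).bddAbove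
  refine ⟨D, fun v => ?_⟩
  have := hD ⟨Quotient.mk _ (Function.update (fun _ => Classical.arbitrary _) i v), rfl⟩
  simpa [φ] using this


/-- Let `T 1, …, T n` (`n ≥ 1`) be locally finite trees with infinitely many vertices and at
least three ends each, and let `G` act on each `T i` by graph automorphisms so that the
diagonal action on the product of the vertex sets is proper and cocompact.
Then every element of the center of `G` has finite order. -/
theorem stmt5 {n : ℕ} (hn : 1 ≤ n) {V : Fin n → Type*} (T : ∀ i, SimpleGraph (V i))
    (htree : ∀ i, (T i).IsTree)
    (hlf : ∀ (i : Fin n) (v : V i), ((T i).neighborSet v).Finite)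
    [∀ i, Infinite (V i)]
    (hends : ∀ i, ∃ e₁ e₂ e₃ : (T i).end, e₁ ≠ e₂ ∧ e₁ ≠ e₃ ∧ e₂ ≠ e₃)
    {G : Type*} [Group G] [∀ i, MulAction G (V i)]
    (hadj : ∀ (i : Fin n) (g : G) (v w : V i), (T i).Adj v w ↔ (T i).Adj (g • v) (g • w))
    (hproper : ∀ (v : ∀ i, V i) (m : ℕ),
      {g : G | ∀ i, (T i).dist (v i) (g • v i) ≤ m}.Finite)
    (hcocompact : Finite (MulAction.orbitRel.Quotient G (∀ i, V i))) :
    ∀ g ∈ Subgroup.center G, IsOfFinOrder g := by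
  classical
  have hc i : (T i).Connected := (htree i).connected
  let F (i : Fin n) (g : G) : T i ≃g T i :=
    { toEquiv := MulAction.toPerm g, map_rel_iff' := fun {v w} => (hadj i g v w).symm }
  have hbound (i : Fin n) : ∃ m : ℕ, ∀ z ∈ Subgroup.center G,
      (T i).dist (Classical.arbitrary (V i)) (z • Classical.arbitrary (V i)) ≤ m := by
    obtain ⟨e₁, e₂, e₃, h₁₂, h₁₃, h₂₃⟩ := hends i
    obtain ⟨m, hm⟩ := (hc i).exists_forall_dist_apply_le (hlf i) ![e₁, e₂, e₃]
      (by
        intro a b hab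
        fin_cases a <;> fin_cases b <;> simp_all [eq_comm])
      (Classical.arbitrary (V i))
    exact ⟨m, fun z hz => hm (F i z)
      (exists_forall_dist_smul_le T (fun i g => (F i g).dist_apply_s5 (hc i)) hcocompact hz i)⟩
  choose m hm using hbound
  intro z hz
  rw [← finite_powers]
  refine (hproper (fun i => Classical.arbitrary (V i)) (Finset.univ.sup m)).subset ?_
  rintro _ ⟨k, rfl⟩ i
  exact (hm i _ (pow_mem hz k)).trans (Finset.le_sup (Finset.mem_univ i))
end

section
/- Let n ≥ 1 and let T_1, …, T_n be locally finite trees, each with infinitely many vertices and each having at least three ends. Let G be a group acting on each T_i by graph automorphisms, and suppose the diagonal action of G on the product V(T_1) × ⋯ × V(T_n) of the vertex sets is proper (for every tuple (v_1,…,v_n) of vertices and every natural number m, the set {g ∈ G : dist(v_j, g·v_j) ≤ m for all j} is finite) and cocompact (there are only finitely many G-orbits of tuples). Then G does not have ℤ as a direct factor: for every group H, there is no group isomorphism between G and H × ℤ. -/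
universe u

namespace SimpleGraph

variable {V : Type*} {Γ : SimpleGraph V} {K : Set V}

/-- Two vertices outside `K` that lie in different components of the complement of `K` are
separated by a vertex of `K` on a geodesic. -/
lemma Connected.exists_mem_dist_add_dist_of_componentComplMk_ne (hΓ : Γ.Connected) {x y : V}
    (hx : x ∉ K) (hy : y ∉ K) (hne : Γ.componentComplMk hx ≠ Γ.componentComplMk hy) :
    ∃ k ∈ K, Γ.dist x k + Γ.dist k y = Γ.dist x y := by
  classical
  obtain ⟨p, hp⟩ := hΓ.exists_walk_length_eq_dist x y
  by_cases h : ∀ u ∈ p.support, u ∈ Kᶜ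
  · exact absurd (ConnectedComponent.eq.2 ⟨p.induce Kᶜ h⟩) hne
  · push Not at h
    obtain ⟨u, hu, huK⟩ := h
    refine ⟨u, not_not.1 huK, le_antisymm ?_ hΓ.dist_triangle⟩
    have h₁ := dist_le (p.takeUntil u hu)
    have h₂ := dist_le (p.dropUntil u hu)
    have h₃ := congrArg Walk.length (p.take_spec hu)
    rw [Walk.length_append] at h₃
    omega

lemma Connected.dist_add_dist_le_of_componentComplMk_ne (hΓ : Γ.Connected) {v : V} {R : ℕ}
    (hR : ∀ k ∈ K, Γ.dist v k ≤ R) {x y : V} (hx : x ∉ K) (hy : y ∉ K)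
    (hne : Γ.componentComplMk hx ≠ Γ.componentComplMk hy) :
    Γ.dist v x + Γ.dist v y ≤ Γ.dist x y + 2 * R := by
  obtain ⟨k, hk, h⟩ := hΓ.exists_mem_dist_add_dist_of_componentComplMk_ne hx hy hne
  have h₁ := hΓ.dist_triangle (u := v) (v := k) (w := x)
  have h₂ := hΓ.dist_triangle (u := v) (v := k) (w := y)
  have := hR k hk
  rw [dist_comm (u := k) (v := x)] at h₁
  omega

lemma Connected.finite_setOf_dist_le_s6 (hΓ : Γ.Connected)
    (hlf : ∀ v, (Γ.neighborSet v).Finite) (v : V) (r : ℕ) : {u | Γ.dist v u ≤ r}.Finite := by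
  induction r with
  | zero =>
    refine (Set.finite_singleton v).subset fun u hu => ?_
    exact (hΓ.dist_eq_zero_iff.1 (Nat.le_zero.1 hu)).symm
  | succ r ih =>
    refine (ih.union (ih.biUnion fun u _ => hlf u)).subset fun u hu => ?_
    obtain ⟨p, hp⟩ := hΓ.exists_walk_length_eq_dist u v
    cases p with
    | nil => exact Or.inl (by simp)
    | @cons _ w _ hadj q =>
      refine Or.inr (Set.mem_biUnion (x := w) ?_ hadj.symm)
      have h := dist_le q
      simp only [Set.mem_ofPred_eq] at hu ⊢
      rw [Walk.length_cons] at hp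
      rw [dist_comm] at hu ⊢
      omega

lemma exists_finset_ne_of_end_ne {e f : Γ.end} (h : e ≠ f) :
    ∃ K : Finset V, ∀ L, K ⊆ L → e.1 (.op L) ≠ f.1 (.op L) := by
  obtain ⟨K, hK⟩ := Function.ne_iff.1 fun h' => h (Subtype.ext h')
  refine ⟨K.unop, fun L hL heq => hK ?_⟩
  rw [← e.2 (CategoryTheory.opHomOfLE hL : .op L ⟶ K),
    ← f.2 (CategoryTheory.opHomOfLE hL : .op L ⟶ K), heq]

/-- Every end contains vertices outside any given finite set. -/
lemma exists_componentComplMk_eq_end (e : Γ.end) {K L : Finset V} (hKL : K ⊆ L) :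
    ∃ x, x ∉ L ∧ ∃ hx : x ∉ (K : Set V), Γ.componentComplMk hx = e.1 (.op K) := by
  obtain ⟨x, hx, h⟩ := ComponentCompl.exists_eq_mk (e.1 (.op L))
  exact ⟨x, hx, _, (end_hom_mk_of_mk Γ e.2
    (CategoryTheory.opHomOfLE hKL : Opposite.op L ⟶ .op K) hx h.symm).symm⟩

/-- In a locally finite connected graph with at least three ends, the isometries of bounded
displacement move a base point by a uniformly bounded amount. -/
lemma Connected.exists_forall_dist_le_of_three_ends (hΓ : Γ.Connected)
    (hlf : ∀ v, (Γ.neighborSet v).Finite) {e₁ e₂ e₃ : Γ.end}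
    (h₁₂ : e₁ ≠ e₂) (h₁₃ : e₁ ≠ e₃) (h₂₃ : e₂ ≠ e₃) (v : V) :
    ∃ D : ℕ, ∀ φ : V → V, (∀ x y, Γ.dist (φ x) (φ y) = Γ.dist x y) →
      (∃ M, ∀ x, Γ.dist x (φ x) ≤ M) → Γ.dist v (φ v) ≤ D := by
  classical
  obtain ⟨K₁, hK₁⟩ := exists_finset_ne_of_end_ne h₁₂
  obtain ⟨K₂, hK₂⟩ := exists_finset_ne_of_end_ne h₁₃
  obtain ⟨K₃, hK₃⟩ := exists_finset_ne_of_end_ne h₂₃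
  obtain ⟨K, hK₁', hK₂', hK₃'⟩ : ∃ K : Finset V, K₁ ⊆ K ∧ K₂ ⊆ K ∧ K₃ ⊆ K :=
    ⟨K₁ ∪ K₂ ∪ K₃, by grind, by grind, by grind⟩
  replace hK₁ := hK₁ K hK₁'
  replace hK₂ := hK₂ K hK₂'
  replace hK₃ := hK₃ K hK₃'
  set R := K.sup (Γ.dist v)
  have hR : ∀ k ∈ (K : Set V), Γ.dist v k ≤ R := fun k hk => Finset.le_sup (f := Γ.dist v) hk
  refine ⟨5 * R, fun φ hφ ⟨M, hM⟩ => ?_⟩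
  have key : ∀ e : Γ.end, ∃ x, ∃ hx : x ∉ (K : Set V), ∃ hx' : φ x ∉ (K : Set V),
      Γ.componentComplMk hx = e.1 (.op K) ∧ Γ.componentComplMk hx' = e.1 (.op K) := by
    intro e
    have hfin := hΓ.finite_setOf_dist_le_s6 hlf v (R + M)
    obtain ⟨x, hxL, hx, hxe⟩ :=
      exists_componentComplMk_eq_end e (Finset.subset_union_left (s₁ := K) (s₂ := hfin.toFinset))
    simp only [Finset.mem_union, Set.Finite.mem_toFinset, Set.mem_ofPred_eq, not_or,
      not_le] at hxL
    have far : ∀ k ∈ (K : Set V), M < Γ.dist x k := by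
      intro k hk
      have h₁ := hR k hk
      have h₂ := hΓ.dist_triangle (u := v) (v := k) (w := x)
      rw [dist_comm (u := k)] at h₂
      omega
    have hx' : φ x ∉ (K : Set V) := fun h => (far _ h).not_ge (hM x)
    refine ⟨x, hx, hx', hxe, ?_⟩
    rw [← hxe]
    by_contra hne
    obtain ⟨k, hk, h⟩ :=
      hΓ.exists_mem_dist_add_dist_of_componentComplMk_ne hx hx' (Ne.symm hne)
    have := far k hk
    have := hM x
    omega
  obtain ⟨x₁, hx₁, hy₁, hc₁, hd₁⟩ := key e₁
  obtain ⟨x₂, hx₂, hy₂, hc₂, hd₂⟩ := key e₂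
  obtain ⟨x₃, hx₃, hy₃, hc₃, hd₃⟩ := key e₃
  have a₁₂ := hΓ.dist_add_dist_le_of_componentComplMk_ne hR hx₁ hx₂ (by rwa [hc₁, hc₂])
  have a₁₃ := hΓ.dist_add_dist_le_of_componentComplMk_ne hR hx₁ hx₃ (by rwa [hc₁, hc₃])
  have a₂₃ := hΓ.dist_add_dist_le_of_componentComplMk_ne hR hx₂ hx₃ (by rwa [hc₂, hc₃])
  have b₁₂ := hΓ.dist_add_dist_le_of_componentComplMk_ne hR hy₁ hy₂ (by rwa [hd₁, hd₂])
  have b₁₃ := hΓ.dist_add_dist_le_of_componentComplMk_ne hR hy₁ hy₃ (by rwa [hd₁, hd₃])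
  have b₂₃ := hΓ.dist_add_dist_le_of_componentComplMk_ne hR hy₂ hy₃ (by rwa [hd₂, hd₃])
  have tri : ∀ x y, Γ.dist x y ≤ Γ.dist v x + Γ.dist v y := fun x y => by
    rw [dist_comm (u := v) (v := x)]
    exact hΓ.dist_triangle
  have c₁₂ := tri x₁ x₂
  have c₁₃ := tri x₁ x₃
  have c₂₃ := tri x₂ x₃
  have d₁₂ := tri (φ x₁) (φ x₂)
  have d₁₃ := tri (φ x₁) (φ x₃)
  have d₂₃ := tri (φ x₂) (φ x₃)
  rw [hφ] at b₁₂ b₁₃ b₂₃ d₁₂ d₁₃ d₂₃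
  by_cases hw : φ v ∈ (K : Set V)
  · have := hR _ hw
    omega
  by_cases hw₁ : Γ.componentComplMk hw = e₁.1 (.op K)
  · have h := hΓ.dist_add_dist_le_of_componentComplMk_ne hR hw hy₂ (by rwa [hw₁, hd₂])
    rw [hφ] at h
    omega
  · have h := hΓ.dist_add_dist_le_of_componentComplMk_ne hR hw hy₁ (by rwa [hd₁])
    rw [hφ] at h
    omega

lemma Connected.dist_smul_smul_s6 (hΓ : Γ.Connected) {G : Type*} [Group G] [MulAction G V]
    (hadj : ∀ (g : G) (v w : V), Γ.Adj v w ↔ Γ.Adj (g • v) (g • w)) (g : G) (v w : V) :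
    Γ.dist (g • v) (g • w) = Γ.dist v w := by
  have key (g : G) (v w : V) : Γ.dist (g • v) (g • w) ≤ Γ.dist v w := by
    obtain ⟨p, hp⟩ := hΓ.exists_walk_length_eq_dist v w
    let f : Γ →g Γ := ⟨(g • ·), (hadj g _ _).1⟩
    exact (dist_le (p.map f)).trans (by rw [Walk.length_map, hp])
  refine (key g v w).antisymm ?_
  simpa using key g⁻¹ (g • v) (g • w)

end SimpleGraph

/-- A group acting properly and cocompactly on a product of connected locally finite graphs, each
with at least three ends, has no central element of infinite order. -/
lemma isOfFinOrder_of_mem_center_of_proper_cocompact {n : ℕ} {V : Fin n → Type*}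
    (T : ∀ i, SimpleGraph (V i)) (hconn : ∀ i, (T i).Connected)
    (hlf : ∀ (i : Fin n) (v : V i), ((T i).neighborSet v).Finite)
    (hends : ∀ i, ∃ e₁ e₂ e₃ : (T i).end, e₁ ≠ e₂ ∧ e₁ ≠ e₃ ∧ e₂ ≠ e₃)
    {G : Type*} [Group G] [∀ i, MulAction G (V i)]
    (hadj : ∀ (i : Fin n) (g : G) (v w : V i), (T i).Adj v w ↔ (T i).Adj (g • v) (g • w))
    (hproper : ∀ (v : ∀ i, V i) (m : ℕ),
      {g : G | ∀ i, (T i).dist (v i) (g • v i) ≤ m}.Finite)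
    (hcocompact : Finite (MulAction.orbitRel.Quotient G (∀ i, V i)))
    {z : G} (hz : z ∈ Subgroup.center G) : IsOfFinOrder z := by
  have v : ∀ i, V i := fun i => (hconn i).nonempty.some
  have hdisp : ∀ c ∈ Subgroup.center G, ∀ i, ∃ M, ∀ x : V i, (T i).dist x (c • x) ≤ M := by
    intro c hc i
    let f : MulAction.orbitRel.Quotient G (∀ i, V i) → ℕ :=
      fun q => (T i).dist (q.out i) (c • q.out i)
    obtain ⟨M, hM⟩ := (Set.finite_range f).bddAbove
    refine ⟨M, fun x => ?_⟩
    let w : ∀ j, V j := Function.update v i x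
    obtain ⟨g, hg⟩ : (⟦w⟧ : MulAction.orbitRel.Quotient G (∀ i, V i)).out ∈ MulAction.orbit G w :=
      MulAction.orbitRel_apply.1 (Quotient.mk_out (s := MulAction.orbitRel G (∀ i, V i)) w)
    have h := hM ⟨⟦w⟧, rfl⟩
    have hgi : (⟦w⟧ : MulAction.orbitRel.Quotient G (∀ i, V i)).out i = g • x := by
      rw [← hg]
      simp [w]
    simp only [f] at h
    rwa [hgi, smul_smul, ← Subgroup.mem_center_iff.1 hc g, mul_smul,
      (hconn i).dist_smul_smul_s6 (hadj i)] at h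
  have hbound : ∀ i, ∃ D, ∀ c ∈ Subgroup.center G, (T i).dist (v i) (c • v i) ≤ D := by
    intro i
    obtain ⟨e₁, e₂, e₃, h₁₂, h₁₃, h₂₃⟩ := hends i
    obtain ⟨D, hD⟩ :=
      (hconn i).exists_forall_dist_le_of_three_ends (hlf i) h₁₂ h₁₃ h₂₃ (v i)
    exact ⟨D, fun c hc => hD (c • ·) ((hconn i).dist_smul_smul_s6 (hadj i) c) (hdisp c hc i)⟩
  choose D hD using hbound
  have hfin : (Subgroup.center G : Set G).Finite :=
    (hproper v (Finset.univ.sup D)).subset fun c hc i =>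
      (hD i c hc).trans (Finset.le_sup (Finset.mem_univ i))
  have hpow : (Submonoid.powers z : Set G).Finite :=
    hfin.subset (Submonoid.powers_le (P := (Subgroup.center G).toSubmonoid).2 hz)
  exact finite_powers.1 hpow

/-- Let `T 1, …, T n` (`n ≥ 1`) be locally finite trees with infinitely many vertices and at
least three ends each, and let `G` act on each `T i` by graph automorphisms so that the
diagonal action on the product of the vertex sets is proper and cocompact.
Then `G` does not have `ℤ` as a direct factor: for every group `H`, there is no group
isomorphism between `G` and `H × ℤ`. -/
theorem stmt6 {n : ℕ} (hn : 1 ≤ n) {V : Fin n → Type*} (T : ∀ i, SimpleGraph (V i))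
    (htree : ∀ i, (T i).IsTree)
    (hlf : ∀ (i : Fin n) (v : V i), ((T i).neighborSet v).Finite)
    [∀ i, Infinite (V i)]
    (hends : ∀ i, ∃ e₁ e₂ e₃ : (T i).end, e₁ ≠ e₂ ∧ e₁ ≠ e₃ ∧ e₂ ≠ e₃)
    {G : Type*} [Group G] [∀ i, MulAction G (V i)]
    (hadj : ∀ (i : Fin n) (g : G) (v w : V i), (T i).Adj v w ↔ (T i).Adj (g • v) (g • w))
    (hproper : ∀ (v : ∀ i, V i) (m : ℕ),
      {g : G | ∀ i, (T i).dist (v i) (g • v i) ≤ m}.Finite)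
    (hcocompact : Finite (MulAction.orbitRel.Quotient G (∀ i, V i))) :
    ∀ (H : Type u) [Group H], IsEmpty (G ≃* H × Multiplicative ℤ) := by
  rintro H _
  refine ⟨fun e => ?_⟩
  let z : G := e.symm (1, Multiplicative.ofAdd 1)
  have hz : z ∈ Subgroup.center G := by
    refine Subgroup.mem_center_iff.2 fun g => e.injective ?_
    ext <;> simp [z, mul_comm]
  have h := isOfFinOrder_of_mem_center_of_proper_cocompact T (fun i => (htree i).connected) hlf
    hends hadj hproper hcocompact hz
  obtain ⟨k, hk, hzk⟩ := isOfFinOrder_iff_pow_eq_one.1 h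
  have h' := congrArg (fun g => (e g).2.toAdd) hzk
  simp [z] at h'
  omega
end

section
/- Let Y be a connected, locally finite simple graph with at least three ends, and let G be a group acting on Y by graph automorphisms such that: (i) the action is cocompact (there are only finitely many orbits of vertices), and (ii) for every finite set K of vertices, every end e of Y, and every finite set L of vertices, there exists g ∈ G such that every vertex of g·K lies in the infinite component of the complement of L determined by e. Then the space of ends of Y is perfect: for every end e and every finite set L of vertices, there exists an end e′ distinct from e such that e′ and e determine the same infinite component of the complement of L. -/
namespace SimpleGraph

open Opposite

variable {V : Type*} {Y : SimpleGraph V}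

/-- The image under an automorphism of a component outside of `K`. -/
def ComponentCompl.mapAut (φ : Y ≃g Y) {K M : Set V} (h : ∀ v, φ v ∈ M ↔ v ∈ K)
    (C : Y.ComponentCompl K) : Y.ComponentCompl M :=
  ConnectedComponent.map
    (⟨fun v => ⟨φ v.1, fun hv => v.2 ((h v.1).1 hv)⟩, fun a => φ.map_adj_iff.2 a⟩ :
      Y.induce Kᶜ →g Y.induce Mᶜ) C

theorem ComponentCompl.map_mem_mapAut (φ : Y ≃g Y) {K M : Set V} (h : ∀ v, φ v ∈ M ↔ v ∈ K)
    {C : Y.ComponentCompl K} {v : V} (hv : v ∈ C) : φ v ∈ C.mapAut φ h := by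
  obtain ⟨hvK, rfl⟩ := hv
  exact ⟨fun hm => hvK ((h v).1 hm), rfl⟩

theorem ComponentCompl.eq_of_mem {K : Set V} {C D : Y.ComponentCompl K} {v : V}
    (hC : v ∈ C) (hD : v ∈ D) : C = D := by
  obtain ⟨_, rfl⟩ := hC
  obtain ⟨_, rfl⟩ := hD
  rfl

theorem ComponentCompl.mapAut_injective (φ : Y ≃g Y) {K M : Set V} (h : ∀ v, φ v ∈ M ↔ v ∈ K) :
    Function.Injective (ComponentCompl.mapAut φ h) := by
  intro C D hCD
  have h' : ∀ v, φ.symm v ∈ K ↔ v ∈ M := fun v => by rw [← h, RelIso.apply_symm_apply]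
  have left_inv : ∀ E : Y.ComponentCompl K, (E.mapAut φ h).mapAut φ.symm h' = E := by
    intro E
    obtain ⟨v, hv⟩ := E.nonempty
    have hv' := map_mem_mapAut φ.symm h' (map_mem_mapAut φ h hv)
    rw [RelIso.symm_apply_apply] at hv'
    exact eq_of_mem hv' hv
  rw [← left_inv C, hCD, left_inv]

theorem end_apply_mono (e : Y.end) {K L : Finset V} (h : K ⊆ L) {v : V}
    (hv : v ∈ ComponentCompl.supp (e.val (op L))) : v ∈ ComponentCompl.supp (e.val (op K)) := by
  have := e.prop (CategoryTheory.opHomOfLE h : op L ⟶ op K)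
  rw [← this]
  exact ComponentCompl.subset_hom (e.val (op L)) h hv

theorem end_apply_ne_of_subset {e f : Y.end} {K L : Finset V} (h : K ⊆ L)
    (hne : e.val (op K) ≠ f.val (op K)) : e.val (op L) ≠ f.val (op L) := by
  intro heq
  apply hne
  rw [← e.prop (CategoryTheory.opHomOfLE h : op L ⟶ op K),
    ← f.prop (CategoryTheory.opHomOfLE h : op L ⟶ op K), heq]

theorem exists_end_apply_ne {e f : Y.end} (h : e ≠ f) :
    ∃ K : Finset V, e.val (op K) ≠ f.val (op K) := by
  by_contra! hall
  exact h (Subtype.ext (funext fun K => hall K.unop))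

theorem mem_map_aut_symm (φ : Y ≃g Y) (K : Finset V) (v : V) :
    φ v ∈ (K : Set V) ↔ v ∈ ((K.map φ.symm.toEquiv.toEmbedding : Finset V) : Set V) := by
  simp only [Finset.mem_coe, Finset.mem_map]
  refine ⟨fun h => ⟨φ v, h, φ.symm_apply_apply v⟩, ?_⟩
  rintro ⟨x, hx, rfl⟩
  exact (φ.apply_symm_apply x).symm ▸ hx

/-- The image of an end under an automorphism. -/
def endMapAut (φ : Y ≃g Y) (e : Y.end) : Y.end :=
  ⟨fun K => ComponentCompl.mapAut φ (mem_map_aut_symm φ K.unop)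
      (e.val (op (K.unop.map φ.symm.toEquiv.toEmbedding))), by
    intro L K f
    have hKL : K.unop ⊆ L.unop := CategoryTheory.leOfHom f.unop
    obtain ⟨v, hv⟩ := ComponentCompl.nonempty
      (e.val (op (L.unop.map φ.symm.toEquiv.toEmbedding)))
    exact ComponentCompl.eq_of_mem
      (ComponentCompl.subset_hom _ hKL (ComponentCompl.map_mem_mapAut φ _ hv))
      (ComponentCompl.map_mem_mapAut φ _ (end_apply_mono e (Finset.map_subset_map.2 hKL) hv))⟩

theorem endMapAut_apply_ne (φ : Y ≃g Y) {e f : Y.end} {K : Finset V}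
    (h : e.val (op K) ≠ f.val (op K)) :
    (endMapAut φ e).val (op (K.map φ.toEquiv.toEmbedding)) ≠
      (endMapAut φ f).val (op (K.map φ.toEquiv.toEmbedding)) := by
  intro heq
  have h' := ComponentCompl.mapAut_injective φ
    (mem_map_aut_symm φ (K.map φ.toEquiv.toEmbedding)) heq
  have hK : (K.map φ.toEquiv.toEmbedding).map φ.symm.toEquiv.toEmbedding = K := by
    ext v
    simp only [Finset.mem_map, exists_exists_and_eq_and]
    constructor
    · rintro ⟨x, hx, rfl⟩
      exact (φ.symm_apply_apply x).symm ▸ hx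
    · exact fun hv => ⟨v, hv, φ.symm_apply_apply v⟩
  rw [hK] at h'
  exact h h'

/-- A preconnected set disjoint from `M` meets at most one component outside of `M`. -/
theorem ComponentCompl.eq_of_mem_of_preconnected {L M : Set V} (hL : (Y.induce L).Preconnected)
    (hLM : Disjoint L M) {C D : Y.ComponentCompl M} {v w : V} (hv : v ∈ L) (hw : w ∈ L)
    (hvC : v ∈ C) (hwD : w ∈ D) : C = D := by
  obtain ⟨p⟩ := hL ⟨v, hv⟩ ⟨w, hw⟩
  have key : ∀ (a b : L), (Y.induce L).Walk a b → a.1 ∈ C → b.1 ∈ C := by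
    intro a b p
    induction p with
    | nil => exact id
    | cons hadj _ ih =>
      exact fun ha => ih (mem_of_adj _ _ ha (Set.disjoint_left.1 hLM (Subtype.prop _)) hadj)
  exact eq_of_mem (key _ _ p hvC) hwD

/-- If `M` is a nonempty subset of a component `C` outside of `L`, then any component outside
of `M` that does not meet `L` is contained in `C`. -/
theorem ComponentCompl.subset_of_disjoint (hY : Y.Preconnected) {L M : Set V} (hM : M.Nonempty)
    {C : Y.ComponentCompl L} (hMC : M ⊆ C) {U : Y.ComponentCompl M}
    (hU : Disjoint (U : Set V) L) : (U : Set V) ⊆ C := by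
  obtain ⟨⟨c, k⟩, hc, hk, hck⟩ := U.exists_adj_boundary_pair hY hM
  have hcC : c ∈ C := mem_of_adj k c (hMC hk) (Set.disjoint_left.1 hU hc) hck.symm
  have key : ∀ (a b : (Mᶜ : Set V)), (Y.induce Mᶜ).Walk a b → a.1 ∈ U → a.1 ∈ C → b.1 ∈ C := by
    intro a b p
    induction p with
    | nil => exact fun _ => id
    | @cons _ b _ hadj _ ih =>
      intro ha haC
      have hb : b.1 ∈ U := mem_of_adj _ _ ha b.2 hadj
      exact ih hb (mem_of_adj _ _ haC (Set.disjoint_left.1 hU hb) hadj)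
  intro v hv
  obtain ⟨hcM, hcU⟩ := id hc
  obtain ⟨hvM, hvU⟩ := id hv
  obtain ⟨p⟩ := ConnectedComponent.exact (hcU.trans hvU.symm)
  exact key _ _ p hc hcC

theorem end_apply_eq_of_disjoint (hY : Y.Preconnected) {L M : Finset V} (hM : M.Nonempty)
    {e f : Y.end} (hMe : ∀ v ∈ M, v ∈ ComponentCompl.supp (e.val (op L)))
    (hf : Disjoint (ComponentCompl.supp (f.val (op M))) (L : Set V)) :
    f.val (op L) = e.val (op L) := by
  classical
  obtain ⟨v, hv⟩ := ComponentCompl.nonempty (f.val (op (L ∪ M)))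
  have hvM := end_apply_mono f Finset.subset_union_right hv
  exact ComponentCompl.eq_of_mem (end_apply_mono f Finset.subset_union_left hv)
    (ComponentCompl.subset_of_disjoint hY (M := (M : Set V)) (C := e.val (op L)) hM hMe
      (U := f.val (op M)) hf hvM)

/-- If three ends are separated by a nonempty finite subset `M` of the component `e L`, where `L`
is preconnected, then some end other than `e` agrees with `e` at `L`. -/
theorem exists_end_ne_apply_eq (hY : Y.Preconnected) {L M : Finset V} (hM : M.Nonempty)
    (hL : (Y.induce (L : Set V)).Preconnected)
    {e f₁ f₂ f₃ : Y.end} (hMe : ∀ v ∈ M, v ∈ ComponentCompl.supp (e.val (op L)))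
    (h₁₂ : f₁.val (op M) ≠ f₂.val (op M)) (h₁₃ : f₁.val (op M) ≠ f₃.val (op M))
    (h₂₃ : f₂.val (op M) ≠ f₃.val (op M)) :
    ∃ e' : Y.end, e' ≠ e ∧ e'.val (op L) = e.val (op L) := by
  have hLM : Disjoint (L : Set V) (M : Set V) :=
    Set.disjoint_right.2 fun v hv => ComponentCompl.notMem_of_mem (C := e.val (op L)) (hMe v hv)
  have agree : ∀ f g : Y.end, f.val (op M) ≠ g.val (op M) →
      f.val (op L) = e.val (op L) ∨ g.val (op L) = e.val (op L) := by
    intro f g hfg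
    by_contra! hcon
    obtain ⟨v, hvf, hvL⟩ :=
      Set.not_disjoint_iff.1 (mt (end_apply_eq_of_disjoint hY hM hMe) hcon.1)
    obtain ⟨w, hwg, hwL⟩ :=
      Set.not_disjoint_iff.1 (mt (end_apply_eq_of_disjoint hY hM hMe) hcon.2)
    exact hfg (ComponentCompl.eq_of_mem_of_preconnected hL hLM hvL hwL hvf hwg)
  have pick : ∀ f g : Y.end, f.val (op M) ≠ g.val (op M) → f.val (op L) = e.val (op L) →
      g.val (op L) = e.val (op L) → ∃ e' : Y.end, e' ≠ e ∧ e'.val (op L) = e.val (op L) := by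
    intro f g hfg hf hg
    by_cases hfe : f = e
    · exact ⟨g, fun hge => hfg (by rw [hfe, hge]), hg⟩
    · exact ⟨f, hfe, hf⟩
  rcases agree f₁ f₂ h₁₂ with h | h
  · rcases agree f₂ f₃ h₂₃ with h' | h'
    · exact pick _ _ h₁₂ h h'
    · exact pick _ _ h₁₃ h h'
  · rcases agree f₁ f₃ h₁₃ with h' | h'
    · exact pick _ _ h₁₂ h' h
    · exact pick _ _ h₂₃ h h'

end SimpleGraph


open Opposite in
/-- Let `Y` be a connected, locally finite simple graph with at least three ends, and let
`G` act on `Y` by graph automorphisms, cocompactly, and so that every compact set can be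
pushed by the action into the neighborhood of any end.  Then the space of ends of `Y` is
perfect: no end is isolated. -/
theorem stmt7 {V : Type*} (Y : SimpleGraph V) (hconn : Y.Connected)
    (hlf : ∀ v : V, (Y.neighborSet v).Finite)
    (hends : ∃ e₁ e₂ e₃ : Y.end, e₁ ≠ e₂ ∧ e₁ ≠ e₃ ∧ e₂ ≠ e₃)
    {G : Type*} [Group G] [MulAction G V]
    (hadj : ∀ (g : G) (v w : V), Y.Adj v w ↔ Y.Adj (g • v) (g • w))
    (hcocompact : Finite (MulAction.orbitRel.Quotient G V))
    (hnull : ∀ (K : Finset V) (e : Y.end) (L : Finset V),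
      ∃ g : G, ∀ x ∈ K, g • x ∈ SimpleGraph.ComponentCompl.supp (e.val (op L))) :
    ∀ (e : Y.end) (L : Finset V),
      ∃ e' : Y.end, e' ≠ e ∧ e'.val (op L) = e.val (op L) := by
  classical
  intro e L
  obtain ⟨e₁, e₂, e₃, h₁₂, h₁₃, h₂₃⟩ := hends
  obtain ⟨K₁₂, hK₁₂⟩ := SimpleGraph.exists_end_apply_ne h₁₂
  obtain ⟨K₁₃, hK₁₃⟩ := SimpleGraph.exists_end_apply_ne h₁₃
  obtain ⟨K₂₃, hK₂₃⟩ := SimpleGraph.exists_end_apply_ne h₂₃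
  obtain ⟨v₀⟩ := hconn.nonempty
  let K : Finset V := insert v₀ (K₁₂ ∪ K₁₃ ∪ K₂₃)
  obtain ⟨L', hLL', hL'⟩ := SimpleGraph.extend_finset_to_connected hconn.preconnected
    (Finset.insert_nonempty v₀ L)
  have hL : L ⊆ L' := (Finset.subset_insert v₀ L).trans hLL'
  obtain ⟨g, hg⟩ := hnull K e L'
  let φ : Y ≃g Y := ⟨MulAction.toPerm g, fun {v w} => (hadj g v w).symm⟩
  have hM : ∀ v ∈ K.map φ.toEquiv.toEmbedding,
      v ∈ SimpleGraph.ComponentCompl.supp (e.val (op L')) := by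
    intro v hv
    obtain ⟨x, hx, rfl⟩ := Finset.mem_map.1 hv
    exact hg x hx
  obtain ⟨e', hne, heq⟩ := SimpleGraph.exists_end_ne_apply_eq hconn.preconnected
    ((Finset.insert_nonempty v₀ _).map (s := K)) hL'.preconnected hM
    (SimpleGraph.endMapAut_apply_ne φ (SimpleGraph.end_apply_ne_of_subset (by grind) hK₁₂))
    (SimpleGraph.endMapAut_apply_ne φ (SimpleGraph.end_apply_ne_of_subset (by grind) hK₁₃))
    (SimpleGraph.endMapAut_apply_ne φ (SimpleGraph.end_apply_ne_of_subset (by grind) hK₂₃))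
  refine ⟨e', hne, ?_⟩
  by_contra hcon
  exact SimpleGraph.end_apply_ne_of_subset hL hcon heq
end
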